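/- Let M > 2 be real, p > 1, and t₁ > 0. Let v ∈ C²([0, t₁]) satisfy -(t^{M-1} v'(t))' = t^{M-1} v(t)^{p} on (0, t₁), with v > 0 on [0, t₁), v(t₁) = 0, v'(0) = 0, and v(0) = max_{[0,t₁]} v =: 𝓜₀. Then for every t ∈ [0, t₁), v(t) ≤ 𝓜₀ (1 + 𝓜₀^{p-1} t² / (M(M-2)))^{-(M-2)/2}. -/

import Mathlib

open Real Filter Set Topology

/-- The Pohozaev-type functional
`t^M v^{p+1} + M t^{M-1} v v' + M/(M-2) t^M v'^2`, with `d` standing for `v'`. -/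
noncomputable def pohozaev (M p : ℝ) (v d : ℝ → ℝ) (t : ℝ) : ℝ :=
  t ^ M * v t ^ (p + 1) + M * (t ^ (M - 1) * (v t * d t)) + M / (M - 2) * (t ^ M * d t ^ 2)

theorem hasDerivAt_pohozaev {M p t : ℝ} {v d : ℝ → ℝ} (hM : 2 < M) (ht : 0 < t) (hv : 0 < v t)
    (hvd : HasDerivAt v (d t) t)
    (hdd : HasDerivAt d (-((M - 1) / t * d t) - v t ^ p) t) :
    HasDerivAt (pohozaev M p v d)
      ((2 * M / (M - 2) - (p + 1)) * (t ^ M * v t ^ p * (-d t))) t := by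
  have h1 : HasDerivAt (fun y : ℝ => y ^ M) (M * t ^ (M - 1)) t :=
    Real.hasDerivAt_rpow_const (Or.inl ht.ne')
  have h2 : HasDerivAt (fun y : ℝ => y ^ (M - 1)) ((M - 1) * t ^ (M - 1 - 1)) t :=
    Real.hasDerivAt_rpow_const (Or.inl ht.ne')
  have h3 := hvd.rpow_const (p := p + 1) (Or.inl hv.ne')
  have h := ((h1.mul h3).add ((h2.mul (hvd.mul hdd)).const_mul M)).add
    ((h1.mul (hdd.pow 2)).const_mul (M / (M - 2)))
  have e1 : t ^ M = t ^ (M - 1 - 1) * t ^ 2 := by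
    rw [← Real.rpow_natCast t 2, ← Real.rpow_add ht]; congr 1; push_cast; ring
  have e2 : t ^ (M - 1) = t ^ (M - 1 - 1) * t := by
    rw [← Real.rpow_add_one ht.ne']; congr 1; ring
  have e3 : v t ^ (p + 1) = v t ^ p * v t := Real.rpow_add_one hv.ne' p
  have e4 : p + 1 - 1 = p := by ring
  have hM2 : M - 2 ≠ 0 := by linarith
  refine h.congr_deriv ?_
  simp only [Pi.mul_apply, Pi.pow_apply]
  rw [e4, e1, e2, e3]
  push_cast
  field_simp
  ring

/-- The quotient `(-v'/t) v^{-M/(M-2)}` has derivative proportional to the Pohozaev functional. -/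
theorem hasDerivAt_neg_div_mul_rpow {M p t : ℝ} {v d : ℝ → ℝ} (hM : 2 < M) (ht : 0 < t)
    (hv : 0 < v t) (hvd : HasDerivAt v (d t) t)
    (hdd : HasDerivAt d (-((M - 1) / t * d t) - v t ^ p) t) :
    HasDerivAt (fun y => -d y / y * v y ^ (-(M / (M - 2))))
      (v t ^ (-(M / (M - 2)) - 1) / (t ^ 2 * t ^ (M - 1)) * pohozaev M p v d t) t := by
  have h := (hdd.neg.div (hasDerivAt_id t) ht.ne').mul
    (hvd.rpow_const (p := -(M / (M - 2))) (Or.inl hv.ne'))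
  refine h.congr_deriv ?_
  have e1 : t ^ M = t ^ (M - 1) * t := by
    rw [← Real.rpow_add_one ht.ne']; congr 1; ring
  have e2 : v t ^ (-(M / (M - 2))) = v t ^ (-(M / (M - 2)) - 1) * v t := by
    rw [← Real.rpow_add_one hv.ne']; congr 1; ring
  have e3 : v t ^ (p + 1) = v t ^ p * v t := Real.rpow_add_one hv.ne' p
  have hM2 : M - 2 ≠ 0 := by linarith
  have hT : t ^ (M - 1) ≠ 0 := (Real.rpow_pos_of_pos ht _).ne'
  simp only [pohozaev, Pi.neg_apply, Pi.div_apply, id]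
  rw [e1, e2, e3]
  generalize v t ^ (-(M / (M - 2)) - 1) = A
  field_simp
  ring

theorem hasDerivAt_rpow_mul_deriv {M p t : ℝ} {v d : ℝ → ℝ} (ht : 0 < t)
    (hdd : HasDerivAt d (-((M - 1) / t * d t) - v t ^ p) t) :
    HasDerivAt (fun y => -(y ^ (M - 1) * d y)) (t ^ (M - 1) * v t ^ p) t := by
  have h2 : HasDerivAt (fun y : ℝ => y ^ (M - 1)) ((M - 1) * t ^ (M - 1 - 1)) t :=
    Real.hasDerivAt_rpow_const (Or.inl ht.ne')
  refine (h2.mul hdd).neg.congr_deriv ?_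
  have e2 : t ^ (M - 1) = t ^ (M - 1 - 1) * t := by
    rw [← Real.rpow_add_one ht.ne']; congr 1; ring
  rw [e2]
  field_simp
  ring

section FirstOrderSystem

variable {M p t₁ : ℝ} {v d : ℝ → ℝ}

theorem deriv_neg_of_laneEmden (hM : 2 < M)
    (hdc : ContinuousOn d (Icc 0 t₁))
    (hdd : ∀ t ∈ Ioo 0 t₁, HasDerivAt d (-((M - 1) / t * d t) - v t ^ p) t)
    (hpos : ∀ x ∈ Ico (0 : ℝ) t₁, 0 < v x) {t : ℝ} (ht : t ∈ Ioo 0 t₁) : d t < 0 := by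
  have hmono : StrictMonoOn (fun y => -(y ^ (M - 1) * d y)) (Icc 0 t₁) := by
    refine strictMonoOn_of_deriv_pos (convex_Icc 0 t₁) ?_ fun x hx => ?_
    · exact ((Real.continuous_rpow_const (by linarith)).continuousOn.mul hdc).neg
    · rw [interior_Icc] at hx
      rw [(hasDerivAt_rpow_mul_deriv hx.1 (hdd x hx)).deriv]
      exact mul_pos (Real.rpow_pos_of_pos hx.1 _)
        (Real.rpow_pos_of_pos (hpos x ⟨hx.1.le, hx.2⟩) _)
  have h := hmono ⟨le_rfl, (ht.1.trans ht.2).le⟩ ⟨ht.1.le, ht.2.le⟩ ht.1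
  simp only [Real.zero_rpow (by linarith : M - 1 ≠ 0), zero_mul, neg_zero] at h
  have := Real.rpow_pos_of_pos ht.1 (M - 1)
  by_contra! hd
  nlinarith [mul_nonneg this.le hd]

theorem tendsto_neg_deriv_div (hM : 2 < M) (hp : 1 < p) (ht₁ : 0 < t₁)
    (hvc : ContinuousOn v (Icc 0 t₁)) (hdc : ContinuousOn d (Icc 0 t₁))
    (hdd : ∀ t ∈ Ioo 0 t₁, HasDerivAt d (-((M - 1) / t * d t) - v t ^ p) t) :
    Tendsto (fun t => -d t / t) (𝓝[>] 0) (𝓝 (v 0 ^ p / M)) := by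
  have hIcc : Icc 0 t₁ ∈ 𝓝[>] (0 : ℝ) := Icc_mem_nhdsGT ht₁
  have hv0 : Tendsto v (𝓝[>] 0) (𝓝 (v 0)) :=
    (hvc 0 ⟨le_rfl, ht₁.le⟩).mono_left (nhdsWithin_le_of_mem hIcc)
  have hd0 : Tendsto d (𝓝[>] 0) (𝓝 (d 0)) :=
    (hdc 0 ⟨le_rfl, ht₁.le⟩).mono_left (nhdsWithin_le_of_mem hIcc)
  have hr : ∀ a : ℝ, 0 < a → Tendsto (fun t : ℝ => t ^ a) (𝓝[>] 0) (𝓝 0) := fun a ha => by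
    have := ((Real.continuous_rpow_const ha.le).tendsto 0).mono_left
      (nhdsWithin_le_nhds (s := Ioi 0))
    rwa [Real.zero_rpow ha.ne'] at this
  have key : Tendsto (fun t => -(t ^ (M - 1) * d t) / t ^ M) (𝓝[>] 0) (𝓝 (v 0 ^ p / M)) := by
    refine HasDerivAt.lhopital_zero_right_on_Ioo (f' := fun t => t ^ (M - 1) * v t ^ p)
      (g' := fun t => M * t ^ (M - 1)) ht₁
      (fun t ht => hasDerivAt_rpow_mul_deriv ht.1 (hdd t ht))
      (fun t ht => Real.hasDerivAt_rpow_const (Or.inl ht.1.ne'))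
      (fun t ht => (mul_pos (by linarith) (Real.rpow_pos_of_pos ht.1 _)).ne') ?_
      (hr M (by linarith)) ?_
    · simpa using ((hr (M - 1) (by linarith)).mul hd0).neg
    · refine ((hv0.rpow_const (p := p) (Or.inr (by linarith))).div_const M).congr' ?_
      filter_upwards [self_mem_nhdsWithin] with t ht
      have := (Real.rpow_pos_of_pos (mem_Ioi.1 ht) (M - 1)).ne'
      field_simp
  refine key.congr' ?_
  filter_upwards [self_mem_nhdsWithin] with t ht
  have ht : 0 < t := ht
  have := (Real.rpow_pos_of_pos ht (M - 1)).ne'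
  have e1 : t ^ M = t ^ (M - 1) * t := by
    rw [← Real.rpow_add_one ht.ne']; congr 1; ring
  rw [e1]
  field_simp

theorem pohozaev_nonneg (hM : 2 < M) (hp : 1 < p) (ht₁ : 0 < t₁)
    (hvc : ContinuousOn v (Icc 0 t₁)) (hdc : ContinuousOn d (Icc 0 t₁))
    (hvd : ∀ t ∈ Ioo 0 t₁, HasDerivAt v (d t) t)
    (hdd : ∀ t ∈ Ioo 0 t₁, HasDerivAt d (-((M - 1) / t * d t) - v t ^ p) t)
    (hpos : ∀ x ∈ Ico (0 : ℝ) t₁, 0 < v x) (hvb : v t₁ = 0) {t : ℝ} (ht : t ∈ Ioo 0 t₁) :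
    0 ≤ pohozaev M p v d t := by
  have hc : ContinuousOn (pohozaev M p v d) (Icc 0 t₁) := by
    have hr : ∀ a : ℝ, 0 ≤ a → ContinuousOn (fun t : ℝ => t ^ a) (Icc 0 t₁) := fun a ha =>
      (Real.continuous_rpow_const ha).continuousOn
    exact (((hr M (by linarith)).mul (hvc.rpow_const fun _ _ => Or.inr (by linarith))).add
      (continuousOn_const.mul ((hr (M - 1) (by linarith)).mul (hvc.mul hdc)))).add
      (continuousOn_const.mul ((hr M (by linarith)).mul (hdc.pow 2)))
  have hderiv : ∀ x ∈ Ioo 0 t₁, deriv (pohozaev M p v d) x =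
      (2 * M / (M - 2) - (p + 1)) * (x ^ M * v x ^ p * (-d x)) := fun x hx =>
    (hasDerivAt_pohozaev hM hx.1 (hpos x ⟨hx.1.le, hx.2⟩) (hvd x hx) (hdd x hx)).deriv
  have hfac : ∀ x ∈ Ioo 0 t₁, 0 < x ^ M * v x ^ p * (-d x) := fun x hx =>
    mul_pos (mul_pos (Real.rpow_pos_of_pos hx.1 _)
      (Real.rpow_pos_of_pos (hpos x ⟨hx.1.le, hx.2⟩) _))
      (neg_pos.2 (deriv_neg_of_laneEmden hM hdc hdd hpos hx))
  have h0 : pohozaev M p v d 0 = 0 := by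
    simp [pohozaev, Real.zero_rpow (by linarith : M ≠ 0), Real.zero_rpow (by linarith : M - 1 ≠ 0)]
  have h1 : 0 ≤ pohozaev M p v d t₁ := by
    simp only [pohozaev, hvb, Real.zero_rpow (by linarith : p + 1 ≠ 0), zero_mul, mul_zero,
      zero_add]
    have : 0 < M - 2 := by linarith
    positivity
  have m0 : (0 : ℝ) ∈ Icc 0 t₁ := ⟨le_rfl, ht₁.le⟩
  rcases le_or_gt (p + 1) (2 * M / (M - 2)) with hsub | hsup
  · have hmono : MonotoneOn (pohozaev M p v d) (Icc 0 t₁) := by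
      refine monotoneOn_of_deriv_nonneg (convex_Icc 0 t₁) hc ?_ fun x hx => ?_ <;>
        rw [interior_Icc] at *
      · exact fun x hx => (hasDerivAt_pohozaev hM hx.1 (hpos x ⟨hx.1.le, hx.2⟩) (hvd x hx)
          (hdd x hx)).differentiableAt.differentiableWithinAt
      · rw [hderiv x hx]
        exact mul_nonneg (by linarith) (hfac x hx).le
    exact h0 ▸ hmono m0 ⟨ht.1.le, ht.2.le⟩ ht.1.le
  · -- the supercritical range is excluded by `v t₁ = 0`
    have hanti : StrictAntiOn (pohozaev M p v d) (Icc 0 t₁) := by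
      refine strictAntiOn_of_deriv_neg (convex_Icc 0 t₁) hc fun x hx => ?_
      rw [interior_Icc] at hx
      rw [hderiv x hx]
      exact mul_neg_of_neg_of_pos (by linarith) (hfac x hx)
    have := hanti m0 ⟨ht₁.le, le_rfl⟩ ht₁
    linarith

theorem le_bubble_of_laneEmden (hM : 2 < M) (hp : 1 < p) (ht₁ : 0 < t₁)
    (hvc : ContinuousOn v (Icc 0 t₁)) (hdc : ContinuousOn d (Icc 0 t₁))
    (hvd : ∀ t ∈ Ioo 0 t₁, HasDerivAt v (d t) t)
    (hdd : ∀ t ∈ Ioo 0 t₁, HasDerivAt d (-((M - 1) / t * d t) - v t ^ p) t)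
    (hpos : ∀ x ∈ Ico (0 : ℝ) t₁, 0 < v x) (hvb : v t₁ = 0) {x : ℝ} (hx : x ∈ Ico 0 t₁) :
    v x ≤ v 0 * (1 + v 0 ^ (p - 1) * x ^ 2 / (M * (M - 2))) ^ (-(M - 2) / 2) := by
  have hM2 : 0 < M - 2 := by linarith
  have hM0 : 0 < M := by linarith
  have hv0 : 0 < v 0 := hpos 0 ⟨le_rfl, ht₁⟩
  have hQd : ∀ t ∈ Ioo 0 t₁, HasDerivAt (fun y => -d y / y * v y ^ (-(M / (M - 2))))
      (v t ^ (-(M / (M - 2)) - 1) / (t ^ 2 * t ^ (M - 1)) * pohozaev M p v d t) t := fun t ht =>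
    hasDerivAt_neg_div_mul_rpow hM ht.1 (hpos t ⟨ht.1.le, ht.2⟩) (hvd t ht) (hdd t ht)
  have hQmono : MonotoneOn (fun y => -d y / y * v y ^ (-(M / (M - 2)))) (Ioo 0 t₁) := by
    refine monotoneOn_of_deriv_nonneg (convex_Ioo 0 t₁)
      (fun t ht => (hQd t ht).continuousAt.continuousWithinAt) ?_ fun t ht => ?_ <;>
      rw [interior_Ioo] at *
    · exact fun t ht => (hQd t ht).differentiableAt.differentiableWithinAt
    · rw [(hQd t ht).deriv]
      have h1 := Real.rpow_pos_of_pos (hpos t ⟨ht.1.le, ht.2⟩) (-(M / (M - 2)) - 1)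
      have h2 := Real.rpow_pos_of_pos ht.1 (M - 1)
      have h3 := pohozaev_nonneg hM hp ht₁ hvc hdc hvd hdd hpos hvb ht
      positivity
  have hv0t : Tendsto v (𝓝[>] 0) (𝓝 (v 0)) :=
    (hvc 0 ⟨le_rfl, ht₁.le⟩).mono_left (nhdsWithin_le_of_mem (Icc_mem_nhdsGT ht₁))
  have hQ : ∀ t ∈ Ioo 0 t₁,
      v 0 ^ p / M * v 0 ^ (-(M / (M - 2))) ≤ -d t / t * v t ^ (-(M / (M - 2))) := by
    intro t ht
    refine le_of_tendsto ((tendsto_neg_deriv_div hM hp ht₁ hvc hdc hdd).mul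
      (hv0t.rpow_const (p := -(M / (M - 2))) (Or.inl hv0.ne'))) ?_
    filter_upwards [Ioo_mem_nhdsGT ht.1] with s hs
    exact hQmono ⟨hs.1, hs.2.trans ht.2⟩ ht hs.2.le
  have hzmono : MonotoneOn (fun y => v y ^ (-2 / (M - 2)) -
      v 0 ^ p / M * v 0 ^ (-(M / (M - 2))) / (M - 2) * y ^ 2) (Ico 0 t₁) := by
    have hzd : ∀ t ∈ Ioo 0 t₁, HasDerivAt (fun y => v y ^ (-2 / (M - 2)) -
        v 0 ^ p / M * v 0 ^ (-(M / (M - 2))) / (M - 2) * y ^ 2)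
        (2 / (M - 2) * t * (-d t / t * v t ^ (-(M / (M - 2))) -
          v 0 ^ p / M * v 0 ^ (-(M / (M - 2))))) t := by
      intro t ht
      have h := ((hvd t ht).rpow_const (p := -2 / (M - 2))
        (Or.inl (hpos t ⟨ht.1.le, ht.2⟩).ne')).sub ((hasDerivAt_pow 2 t).const_mul
          (v 0 ^ p / M * v 0 ^ (-(M / (M - 2))) / (M - 2)))
      refine h.congr_deriv ?_
      have e : -2 / (M - 2) - 1 = -(M / (M - 2)) := by field_simp; ring
      have := ht.1.ne'
      rw [e]
      generalize v t ^ (-(M / (M - 2))) = A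
      generalize v 0 ^ (-(M / (M - 2))) = B
      push_cast
      field_simp
    refine monotoneOn_of_deriv_nonneg (convex_Ico 0 t₁) ?_ ?_ fun t ht => ?_
    · exact ((hvc.mono Ico_subset_Icc_self).rpow_const fun y hy => Or.inl (hpos y hy).ne').sub
        (by fun_prop)
    · rw [interior_Ico]
      exact fun t ht => (hzd t ht).differentiableAt.differentiableWithinAt
    · rw [interior_Ico] at ht
      rw [(hzd t ht).deriv]
      have := ht.1
      exact mul_nonneg (by positivity) (sub_nonneg.2 (hQ t ht))
  have hz := hzmono ⟨le_rfl, ht₁⟩ hx hx.1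
  have hvx := hpos x hx
  have hB : 0 < 1 + v 0 ^ (p - 1) * x ^ 2 / (M * (M - 2)) := by
    have := Real.rpow_pos_of_pos hv0 (p - 1)
    positivity
  have e : v 0 ^ p * v 0 ^ (-(M / (M - 2))) = v 0 ^ (-2 / (M - 2)) * v 0 ^ (p - 1) := by
    rw [← Real.rpow_add hv0, ← Real.rpow_add hv0]
    congr 1
    field_simp
    ring
  have hz' : v 0 ^ (-2 / (M - 2)) * (1 + v 0 ^ (p - 1) * x ^ 2 / (M * (M - 2))) ≤
      v x ^ (-2 / (M - 2)) := by
    have e' : v 0 ^ p / M * v 0 ^ (-(M / (M - 2))) / (M - 2) * x ^ 2 =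
        v 0 ^ (-2 / (M - 2)) * (v 0 ^ (p - 1) * x ^ 2 / (M * (M - 2))) := by
      rw [div_mul_eq_mul_div (v 0 ^ p), e]
      field_simp
    simp only [e'] at hz
    norm_num at hz
    linarith
  have hpow : ∀ y : ℝ, 0 < y → (y ^ (-2 / (M - 2))) ^ (-(M - 2) / 2) = y := fun y hy => by
    rw [← Real.rpow_mul hy.le]
    have : -2 / (M - 2) * (-(M - 2) / 2) = 1 := by field_simp
    rw [this, Real.rpow_one]
  have hfin := Real.rpow_le_rpow_of_nonpos (z := -(M - 2) / 2)
    (mul_pos (Real.rpow_pos_of_pos hv0 _) hB) hz' (by linarith)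
  rwa [Real.mul_rpow (Real.rpow_pos_of_pos hv0 _).le hB.le, hpow _ hv0, hpow _ hvx] at hfin

end FirstOrderSystem

/-- pointwise upper bound in the first nodal zone. If `v ∈ C²([0,t₁])` solves the
generalized Lane–Emden equation on `(0,t₁)`, is positive on `[0,t₁)`, `v(t₁) = 0`, `v'(0) = 0`
and `v(0) = max v = 𝓜₀`, then `v(t) ≤ 𝓜₀ (1 + 𝓜₀^{p-1} t²/(M(M-2)))^{-(M-2)/2}` on `[0,t₁)`. -/
theorem stmt13 (M p t₁ : ℝ) (hM : 2 < M) (hp : 1 < p) (ht₁ : 0 < t₁)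
    (v : ℝ → ℝ) (hreg : ContDiffOn ℝ 2 v (Set.Icc 0 t₁))
    (hode : ∀ x ∈ Set.Ioo (0 : ℝ) t₁,
      -(deriv (fun y : ℝ => y ^ (M - 1) * deriv v y) x) = x ^ (M - 1) * v x ^ p)
    (hpos : ∀ x ∈ Set.Ico (0 : ℝ) t₁, 0 < v x)
    (hvb : v t₁ = 0) (hd0 : deriv v 0 = 0)
    (hmax : ∀ x ∈ Set.Icc (0 : ℝ) t₁, v x ≤ v 0) :
    ∀ x ∈ Set.Ico (0 : ℝ) t₁,
      v x ≤ v 0 * (1 + v 0 ^ (p - 1) * x ^ 2 / (M * (M - 2))) ^ (-(M - 2) / 2) := by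
  intro x hx
  have huniq : UniqueDiffOn ℝ (Icc 0 t₁) := uniqueDiffOn_Icc ht₁
  have hd1 : ContDiffOn ℝ 1 (derivWithin v (Icc 0 t₁)) (Icc 0 t₁) :=
    hreg.derivWithin huniq (by norm_num)
  have hnhds : ∀ t ∈ Ioo 0 t₁, Icc 0 t₁ ∈ 𝓝 t := fun t ht => Icc_mem_nhds ht.1 ht.2
  have heq : ∀ t ∈ Ioo 0 t₁, derivWithin v (Icc 0 t₁) t = deriv v t := fun t ht =>
    derivWithin_of_mem_nhds (hnhds t ht)
  refine le_bubble_of_laneEmden (d := derivWithin v (Icc 0 t₁)) hM hp ht₁ hreg.continuousOn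
    hd1.continuousOn (fun t ht => ?_) (fun t ht => ?_) hpos hvb hx
  · rw [heq t ht]
    exact ((hreg.contDiffAt (hnhds t ht)).differentiableAt (by norm_num)).hasDerivAt
  · have hdd := ((hd1.contDiffAt (hnhds t ht)).differentiableAt (by norm_num)).hasDerivAt
    have h2 : HasDerivAt (fun y : ℝ => y ^ (M - 1)) ((M - 1) * t ^ (M - 1 - 1)) t :=
      Real.hasDerivAt_rpow_const (Or.inl ht.1.ne')
    have hev : (fun y : ℝ => y ^ (M - 1) * deriv v y) =ᶠ[𝓝 t]
        fun y => y ^ (M - 1) * derivWithin v (Icc 0 t₁) y := by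
      filter_upwards [Ioo_mem_nhds ht.1 ht.2] with y hy
      rw [heq y hy]
    have hflux := ((h2.mul hdd).congr_of_eventuallyEq hev).deriv
    have hflux' := hode t ht
    rw [hflux] at hflux'
    refine hdd.congr_deriv ?_
    have e2 : t ^ (M - 1) = t ^ (M - 1 - 1) * t := by
      rw [← Real.rpow_add_one ht.1.ne']; congr 1; ring
    have hT := (Real.rpow_pos_of_pos ht.1 (M - 1 - 1)).ne'
    have ht0 := ht.1.ne'
    rw [e2] at hflux'
    apply mul_left_cancel₀ (mul_ne_zero hT ht0)
    field_simp
    field_simp at hflux'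
    linarith
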